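/- For every n ≥ 1 there exists a bijection φ from the set D_n of Dyck paths of length n onto the set NC(n) of non-crossing permutations of {1,…,n} such that area(w) = inv(φ(w)) for every w ∈ D_n. -/

import Mathlib

open scoped Classical

namespace Stmt

/-- Number of north steps (`true`) among the first `k` steps of the path `w`. -/
def countN {m : ℕ} (w : Fin m → Bool) (k : ℕ) : ℕ :=
  (Finset.univ.filter (fun t : Fin m => (t : ℕ) < k ∧ w t = true)).card

/-- Number of east steps (`false`) among the first `k` steps of the path `w`. -/
def countE {m : ℕ} (w : Fin m → Bool) (k : ℕ) : ℕ :=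
  (Finset.univ.filter (fun t : Fin m => (t : ℕ) < k ∧ w t = false)).card

/-- A Dyck path of length `n`: `n` north and `n` east steps, every prefix has
at least as many north as east steps. -/
def IsDyckA (n : ℕ) (w : Fin (2 * n) → Bool) : Prop :=
  countN w (2 * n) = n ∧ ∀ k : ℕ, countE w k ≤ countN w k

/-- A Dyck path of type `B_n`: `2n` steps, every prefix has at least as many
north as east steps. -/
def IsDyckB (n : ℕ) (w : Fin (2 * n) → Bool) : Prop :=
  ∀ k : ℕ, countE w k ≤ countN w k

/-- The unit cell `[i-1,i] × [j-1,j]` lies below the lattice path `w`: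
at some time the path has `x`-coordinate `< i` and `y`-coordinate `≥ j`. -/
def CellBelow {m : ℕ} (w : Fin m → Bool) (i j : ℕ) : Prop :=
  ∃ k : ℕ, countE w k < i ∧ j ≤ countN w k

/-- Area of a (type `A`) Dyck path: number of cells `b_{i,j}` with `i < j`
lying below the path. -/
noncomputable def areaA {m : ℕ} (w : Fin m → Bool) : ℕ :=
  {p : ℕ × ℕ | 1 ≤ p.1 ∧ p.1 < p.2 ∧ CellBelow w p.1 p.2}.ncard

/-- Area of a type `B_n` Dyck path: number of cells `b_{i,j}` with
`1 ≤ i < j ≤ 2n+1-i` lying below the path. -/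
noncomputable def areaB (n : ℕ) (w : Fin (2 * n) → Bool) : ℕ :=
  {p : ℕ × ℕ | 1 ≤ p.1 ∧ p.1 < p.2 ∧ p.2 ≤ 2 * n + 1 - p.1 ∧
    CellBelow w p.1 p.2}.ncard

/-- Descent set of a path, 1-indexed: positions `i` with `w_i = E`, `w_{i+1} = N`. -/
def pathDes {m : ℕ} (w : Fin m → Bool) : Finset ℕ :=
  (Finset.Ioo 0 m).filter (fun i =>
    ∃ h : i < m, w ⟨i - 1, Nat.lt_of_le_of_lt (Nat.sub_le i 1) h⟩ = false ∧ w ⟨i, h⟩ = true)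

def desPath {m : ℕ} (w : Fin m → Bool) : ℕ := (pathDes w).card

/-- Major index of a Dyck path of length `n`: `maj(w) = ∑_{i ∈ Des(w)} (2n - i)`. -/
def majA (n : ℕ) (w : Fin (2 * n) → Bool) : ℕ :=
  ∑ i ∈ pathDes w, (2 * n - i)

/-- Number of east steps of a path. -/
def negPath {m : ℕ} (w : Fin m → Bool) : ℕ :=
  (Finset.univ.filter (fun t : Fin m => w t = false)).card

/-- Type `B` major index: `maj(w) = 2 ⬝ (neg(w) + ∑_{i ∈ Des(w)} (2n - i))`. -/
def majB (n : ℕ) (w : Fin (2 * n) → Bool) : ℕ :=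
  2 * (negPath w + ∑ i ∈ pathDes w, (2 * n - i))

/-- Number of inversions of a permutation of `{1,…,n}`. -/
def invP {n : ℕ} (σ : Equiv.Perm (Fin n)) : ℕ :=
  (Finset.univ.filter (fun p : Fin n × Fin n => p.1 < p.2 ∧ σ p.2 < σ p.1)).card

/-- Descent set of a permutation, as 1-indexed positions in `{1,…,n-1}`. -/
def permDes {n : ℕ} (σ : Equiv.Perm (Fin n)) : Finset ℕ :=
  (Finset.Ico 1 n).filter (fun i =>
    ∃ h : i < n, σ ⟨i, h⟩ < σ ⟨i - 1, Nat.lt_of_le_of_lt (Nat.sub_le i 1) h⟩)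

def desP {n : ℕ} (σ : Equiv.Perm (Fin n)) : ℕ := (permDes σ).card

def majP {n : ℕ} (σ : Equiv.Perm (Fin n)) : ℕ := ∑ i ∈ permDes σ, i

def imajP {n : ℕ} (σ : Equiv.Perm (Fin n)) : ℕ := majP σ⁻¹

/-- Every orbit of `σ` is an increasing cycle: each element is mapped to the
next larger element of its orbit, the largest being mapped to the smallest. -/
def IncCycles {n : ℕ} (σ : Equiv.Perm (Fin n)) : Prop :=
  ∀ x : Fin n,
    ((∃ y, σ.SameCycle x y ∧ x < y) →
      x < σ x ∧ ∀ y, σ.SameCycle x y → x < y → σ x ≤ y) ∧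
    ((∀ y, σ.SameCycle x y → y ≤ x) → ∀ y, σ.SameCycle x y → σ x ≤ y)

/-- No two distinct orbits of `σ` cross. -/
def NoCrossing {n : ℕ} (σ : Equiv.Perm (Fin n)) : Prop :=
  ¬ ∃ a b c d : Fin n, a < b ∧ b < c ∧ c < d ∧
      σ.SameCycle a c ∧ σ.SameCycle b d ∧ ¬σ.SameCycle a b

/-- Non-crossing permutations of `{1,…,n}`. -/
def IsNC {n : ℕ} (σ : Equiv.Perm (Fin n)) : Prop := IncCycles σ ∧ NoCrossing σ

/-! ### A local description of non-crossing permutations -/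

/-- Each ascending arc encloses an invariant open interval, and each descending arc bounds an
invariant closed interval. -/
def LocalNC {α : Type*} [LinearOrder α] (f : α → α) : Prop :=
  ∀ x z, (x < z → z < f x → x < f z ∧ f z < f x) ∧ (f x ≤ z → z < x → f x < f z ∧ f z ≤ x)

lemma sameCycle_mem {α : Type*} [Finite α] {σ : Equiv.Perm α} {s : Set α}
    (hs : Set.MapsTo σ s s) {x y : α} (h : σ.SameCycle x y) (hx : x ∈ s) : y ∈ s := by
  obtain ⟨i, -, -, rfl⟩ := h.exists_pow_eq'
  rw [Equiv.Perm.coe_pow]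
  exact hs.iterate i hx

lemma sameCycle_apply {α : Type*} (σ : Equiv.Perm α) (x : α) : σ.SameCycle x (σ x) :=
  Equiv.Perm.sameCycle_apply_right.2 (Equiv.Perm.SameCycle.refl σ x)

lemma IsNC.localNC {n : ℕ} {σ : Equiv.Perm (Fin n)} (h : IsNC σ) : LocalNC σ := by
  obtain ⟨hinc, hcross⟩ := h
  have cross {a b c d : Fin n} (h1 : a < b) (h2 : b < c) (h3 : c < d) (h4 : σ.SameCycle a c)
      (h5 : σ.SameCycle b d) : σ.SameCycle a b := by
    by_contra h6
    exact hcross ⟨a, b, c, d, h1, h2, h3, h4, h5, h6⟩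
  have self := sameCycle_apply σ
  refine fun x z => ⟨fun h1 h2 => ?_, fun h1 h2 => ?_⟩
  · have hxz : ¬ σ.SameCycle x z := fun h =>
      (((hinc x).1 ⟨z, h, h1⟩).2 z h h1).not_gt h2
    constructor
    · by_contra! h3
      rcases h3.lt_or_eq with h3 | h3
      · exact hxz ((cross h3 h1 h2 (self z).symm (self x)).symm.trans (self z).symm)
      · exact hxz (h3 ▸ (self z).symm)
    · by_contra! h3
      rcases h3.lt_or_eq with h3 | h3
      · exact hxz (cross h1 h2 h3 (self x) (self z))
      · exact h1.ne (σ.injective h3)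
  · have hmax : ∀ y, σ.SameCycle x y → y ≤ x := by
      by_contra! h3
      have := ((hinc x).1 h3).1
      order
    have hmin := (hinc x).2 hmax
    by_cases hxz : σ.SameCycle x z
    · have h3 := ((hinc z).1 ⟨x, hxz.symm, h2⟩).1
      exact ⟨h1.trans_lt h3, hmax _ (hxz.trans (self z))⟩
    · have h4 : σ x < z := h1.lt_of_ne fun h => hxz (h ▸ self x)
      constructor
      · by_contra! h3
        rcases h3.lt_or_eq with h3 | h3
        · exact hxz (((self x).trans (cross h3 h4 h2 (self z).symm (self x).symm).symm).trans
            (self z).symm)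
        · exact h2.ne (σ.injective h3)
      · by_contra! h3
        exact hxz ((self x).trans (cross h4 h2 h3 (self x).symm (self z)))

lemma LocalNC.isNC {n : ℕ} {σ : Equiv.Perm (Fin n)} (h : LocalNC σ) : IsNC σ := by
  have up {x y : Fin n} (h1 : x < y) (h2 : y < σ x) {z : Fin n} (h3 : σ.SameCycle y z) :
      x < z ∧ z < σ x :=
    sameCycle_mem (s := {z | x < z ∧ z < σ x}) (fun w hw => (h x w).1 hw.1 hw.2) h3 ⟨h1, h2⟩
  have down {x z : Fin n} (h1 : σ x < x) (h3 : σ.SameCycle x z) : σ x ≤ z ∧ z ≤ x := by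
    refine sameCycle_mem (s := {z | σ x ≤ z ∧ z ≤ x}) (fun w hw => ?_) h3 ⟨h1.le, le_rfl⟩
    rcases hw.2.lt_or_eq with h4 | rfl
    · exact ⟨((h x w).2 hw.1 h4).1.le, ((h x w).2 hw.1 h4).2⟩
    · exact ⟨le_rfl, h1.le⟩
  have fixed {x z : Fin n} (h1 : σ x = x) (h3 : σ.SameCycle x z) : z = x :=
    sameCycle_mem (s := {z | z = x}) (fun w hw => by simp_all) h3 rfl
  have hinc : IncCycles σ := by
    refine fun x => ⟨fun ⟨y, hy, hxy⟩ => ⟨?_, fun z hz hxz => ?_⟩, fun hmax z hz => ?_⟩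
    · by_contra! h1
      rcases h1.lt_or_eq with h1 | h1
      · exact (down h1 hy).2.not_gt hxy
      · exact hxy.ne' (fixed h1 hy)
    · by_contra! h1
      exact lt_irrefl _ (up hxz h1 hz.symm).1
    · rcases (hmax _ (sameCycle_apply σ x)).lt_or_eq with h1 | h1
      · exact (down h1 hz).1
      · rw [h1, fixed h1 hz]
  refine ⟨hinc, ?_⟩
  rintro ⟨a, b, c, d, hab, hbc, hcd, hac, hbd, hn⟩
  obtain ⟨x, ⟨hax, hxb⟩, hx⟩ := (Set.toFinite {x | σ.SameCycle a x ∧ x < b}).exists_maximal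
    ⟨a, Equiv.Perm.SameCycle.refl _ _, hab⟩
  have hxc := (hinc x).1 ⟨c, hax.symm.trans hac, hxb.trans hbc⟩
  have hsx := hax.trans (sameCycle_apply σ x)
  have h1 : b < σ x := by
    by_contra! h1
    rcases h1.lt_or_eq with h1 | h1
    · exact (hx ⟨hsx, h1⟩ hxc.1.le).not_gt hxc.1
    · exact hn (h1 ▸ hsx)
  have := (up hxb h1 hbd).2
  have := hxc.2 c (hax.symm.trans hac) (hxb.trans hbc)
  order

lemma isNC_iff_localNC {n : ℕ} {σ : Equiv.Perm (Fin n)} : IsNC σ ↔ LocalNC σ :=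
  ⟨IsNC.localNC, LocalNC.isNC⟩

/-! ### Non-crossing permutations from binary trees -/

open BinaryTree

/-- The statistic on binary trees matching the number of inversions. -/
def arcWeight : BinaryTree Unit → ℕ
  | nil => 0
  | node _ u v => arcWeight u + arcWeight v + if v = nil then 0 else 2 * u.numNodes + 1

/-- The non-crossing permutation of `[a, a + t.numNodes)` encoded by `t`. -/
noncomputable def treePerm : BinaryTree Unit → ℕ → Equiv.Perm ℕ
  | nil, _ => 1
  | node _ u v, a =>
    Equiv.swap a (if v = nil then a else a + 1 + u.numNodes) *
      (treePerm u (a + 1) * treePerm v (a + 1 + u.numNodes))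

/-- `σ` is a non-crossing permutation of the interval `[a, b)`. -/
def IsNCOn (a b : ℕ) (σ : Equiv.Perm ℕ) : Prop :=
  (∀ x, x < a ∨ b ≤ x → σ x = x) ∧ LocalNC σ

/-- The inversions of `σ` inside `[0, N)`. -/
def invSet (N : ℕ) (σ : Equiv.Perm ℕ) : Finset (ℕ × ℕ) :=
  (Finset.range N ×ˢ Finset.range N).filter fun p => p.1 < p.2 ∧ σ p.2 < σ p.1

lemma IsNCOn.mem {a b : ℕ} {σ : Equiv.Perm ℕ} (h : IsNCOn a b σ) {x : ℕ} :
    (a ≤ x ∧ x < b) ↔ a ≤ σ x ∧ σ x < b := by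
  have key (x : ℕ) (hx : ¬ (a ≤ x ∧ x < b)) : σ x = x := h.1 x (by omega)
  by_cases h1 : a ≤ x ∧ x < b <;> by_cases h2 : a ≤ σ x ∧ σ x < b
  · simp [h1, h2]
  · have := σ.injective (key _ h2)
    rw [this] at h2
    exact absurd h1 h2
  · rw [key _ h1] at h2
    exact absurd h2 h1
  · simp [h1, h2]

lemma numNodes_pos {v : BinaryTree Unit} (h : v ≠ nil) : 0 < v.numNodes := by
  cases v
  · exact absurd rfl h
  · simp [numNodes]

section Glue

variable {a j b : ℕ} {τ₁ τ₂ : Equiv.Perm ℕ}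

lemma glue_apply (haj : a < j) (h₁ : IsNCOn (a + 1) j τ₁) (h₂ : IsNCOn j b τ₂) (x : ℕ) :
    (Equiv.swap a j * (τ₁ * τ₂)) x =
      if x < a then x else if x = a then j else if x < j then τ₁ x else
        if τ₂ x = j then a else τ₂ x := by
  simp only [Equiv.Perm.mul_apply]
  split_ifs with c1 c2 c3 c4
  · rw [h₂.1 x (by omega), h₁.1 x (by omega), Equiv.swap_apply_of_ne_of_ne] <;> omega
  · rw [h₂.1 x (by omega), h₁.1 x (by omega), c2, Equiv.swap_apply_left]
  · have := (h₁.mem (x := x)).1 (by omega)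
    rw [h₂.1 x (by omega), Equiv.swap_apply_of_ne_of_ne] <;> omega
  · rw [c4, h₁.1 j (by omega), Equiv.swap_apply_right]
  · have : j ≤ τ₂ x := by
      by_cases hx : x < b
      · exact ((h₂.mem (x := x)).1 (by omega)).1
      · rw [h₂.1 x (by omega)]; omega
    rw [h₁.1 _ (by omega), Equiv.swap_apply_of_ne_of_ne] <;> omega

lemma mul_apply_of_disjoint (h₁ : IsNCOn (a + 1) j τ₁) (h₂ : IsNCOn j b τ₂)
    (x : ℕ) : (τ₁ * τ₂) x = if x < j then τ₁ x else τ₂ x := by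
  simp only [Equiv.Perm.mul_apply]
  split_ifs with c
  · rw [h₂.1 x (by omega)]
  · have : j ≤ τ₂ x := by
      by_cases hx : x < b
      · exact ((h₂.mem (x := x)).1 (by omega)).1
      · rw [h₂.1 x (by omega)]; omega
    exact h₁.1 _ (by omega)

lemma isNCOn_glue (haj : a < j) (hjb : j < b) (h₁ : IsNCOn (a + 1) j τ₁) (h₂ : IsNCOn j b τ₂) :
    IsNCOn a b (Equiv.swap a j * (τ₁ * τ₂)) := by
  have hσ := glue_apply haj h₁ h₂
  have m₁ := fun x => h₁.mem (x := x)
  have m₂ := fun x => h₂.mem (x := x)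
  have l₁ := h₁.2
  have l₂ := h₂.2
  have f₁ := h₁.1
  have f₂ := h₂.1
  generalize Equiv.swap a j * (τ₁ * τ₂) = σ at *
  refine ⟨fun x hx => ?_, fun x z => ?_⟩
  · grind
  · have q₁ := l₁ x z
    have q₂ := l₂ x z
    have q₃ := τ₂.injective.eq_iff (a := x) (b := z)
    have := m₁ x
    have := m₁ z
    have := m₂ x
    have := m₂ z
    have := f₂ x
    have := f₂ z
    have := f₁ x
    have := f₁ z
    have e1 := hσ x
    have e2 := hσ z
    clear hσ m₁ m₂ l₁ l₂ f₁ f₂ h₁ h₂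
    generalize σ x = p at *
    generalize σ z = q at *
    generalize τ₁ x = p1 at *
    generalize τ₁ z = q1 at *
    generalize τ₂ x = p2 at *
    generalize τ₂ z = q2 at *
    split_ifs at e1 e2 <;> subst e1 <;> subst e2 <;> omega

end Glue
@[simp] lemma treePerm_node_nil (i : Unit) (u : BinaryTree Unit) (a : ℕ) :
    treePerm (node i u nil) a = treePerm u (a + 1) := by
  rw [treePerm, if_pos rfl, treePerm, mul_one, Equiv.swap_self]
  exact one_mul _

lemma treePerm_node_of_ne (i : Unit) (u : BinaryTree Unit) {v : BinaryTree Unit} (hv : v ≠ nil)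
    (a : ℕ) : treePerm (node i u v) a = Equiv.swap a (a + 1 + u.numNodes) *
      (treePerm u (a + 1) * treePerm v (a + 1 + u.numNodes)) := by
  simp [treePerm, hv]

lemma isNCOn_treePerm (t : BinaryTree Unit) (a : ℕ) :
    IsNCOn a (a + t.numNodes) (treePerm t a) := by
  induction t generalizing a with
  | nil =>
    refine ⟨fun x _ => rfl, fun x z => ?_⟩
    simp only [treePerm, Equiv.Perm.coe_one, id]
    omega
  | node i u v ihu ihv =>
    by_cases hv : v = nil
    · subst hv
      rw [treePerm_node_nil]
      refine ⟨fun x hx => (ihu (a + 1)).1 x ?_, (ihu (a + 1)).2⟩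
      simp only [numNodes] at hx
      omega
    · rw [treePerm_node_of_ne i u hv]
      have := isNCOn_glue (a := a) (by omega) (Nat.lt_add_of_pos_right (numNodes_pos hv))
        (ihu (a + 1)) (ihv (a + 1 + u.numNodes))
      convert this using 1
      simp only [numNodes]
      omega

lemma card_invSet_glue {a j b N : ℕ} {τ₁ τ₂ : Equiv.Perm ℕ} (haj : a < j) (hjb : j < b)
    (hN : b ≤ N) (h₁ : IsNCOn (a + 1) j τ₁) (h₂ : IsNCOn j b τ₂) :
    (invSet N (Equiv.swap a j * (τ₁ * τ₂))).card =
      (invSet N τ₁).card + (invSet N τ₂).card + (2 * (j - (a + 1)) + 1) := by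
  obtain ⟨k, hk⟩ := τ₂.surjective j
  have hσ := glue_apply haj h₁ h₂
  have m₁ := fun x => h₁.mem (x := x)
  have m₂ := fun x => h₂.mem (x := x)
  have f₁ := h₁.1
  have f₂ := h₂.1
  generalize Equiv.swap a j * (τ₁ * τ₂) = σ at *
  have hk' : j ≤ k ∧ k < b := (m₂ k).2 (by omega)
  have key : invSet N σ = ((invSet N τ₁ ∪ invSet N τ₂) ∪
      ((Finset.Ioo a j).image (fun x => (a, x)) ∪ (Finset.Ico a j).image (fun x => (x, k)))) := by
    ext ⟨x, y⟩
    simp only [invSet, Finset.mem_union, Finset.mem_filter, Finset.mem_product, Finset.mem_range,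
      Finset.mem_image, Finset.mem_Ioo, Finset.mem_Ico, Prod.mk.injEq]
    have s1 : (∃ z, (a < z ∧ z < j) ∧ a = x ∧ z = y) ↔ (a < y ∧ y < j) ∧ a = x := by grind
    have s2 : (∃ z, (a ≤ z ∧ z < j) ∧ z = x ∧ k = y) ↔ (a ≤ x ∧ x < j) ∧ k = y := by grind
    rw [s1, s2]
    have q := τ₂.injective.eq_iff (a := k) (b := x)
    have q := τ₂.injective.eq_iff (a := k) (b := y)
    have := m₁ x
    have := m₁ y
    have := m₂ x
    have := m₂ y
    have := f₂ x
    have := f₂ y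
    have := f₁ x
    have := f₁ y
    have e1 := hσ x
    have e2 := hσ y
    clear hσ m₁ m₂ f₁ f₂ h₁ h₂ s1 s2
    generalize σ x = p at *
    generalize σ y = q at *
    generalize τ₁ x = p1 at *
    generalize τ₁ y = q1 at *
    generalize τ₂ x = p2 at *
    generalize τ₂ y = q2 at *
    split_ifs at e1 e2 <;> subst e1 <;> subst e2 <;> omega
  have i₁ : ∀ x y, x < y → τ₁ y < τ₁ x → a < x ∧ y < j := by
    intro x y h1 h2
    have := m₁ x
    have := m₁ y
    have := f₁ x
    have := f₁ y
    omega
  have i₂ : ∀ x y, x < y → τ₂ y < τ₂ x → j ≤ x := by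
    intro x y h1 h2
    have := m₂ x
    have := m₂ y
    have := f₂ x
    have := f₂ y
    omega
  rw [key, Finset.card_union_of_disjoint, Finset.card_union_of_disjoint,
    Finset.card_union_of_disjoint, Finset.card_image_of_injective, Finset.card_image_of_injective,
    Nat.card_Ioo, Nat.card_Ico]
  · omega
  · intro x y; simp
  · intro x y; simp
  all_goals
    rw [Finset.disjoint_left]
    rintro ⟨x, y⟩
    simp only [invSet, Finset.mem_union, Finset.mem_filter, Finset.mem_product, Finset.mem_range,
      Finset.mem_image, Finset.mem_Ioo, Finset.mem_Ico, Prod.mk.injEq]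
    grind

lemma card_invSet_treePerm (t : BinaryTree Unit) (a : ℕ) {N : ℕ} (hN : a + t.numNodes ≤ N) :
    (invSet N (treePerm t a)).card = arcWeight t := by
  induction t generalizing a with
  | nil =>
    rw [arcWeight, Finset.card_eq_zero, invSet, Finset.filter_eq_empty_iff]
    simp only [treePerm, Equiv.Perm.coe_one, id]
    omega
  | node i u v ihu ihv =>
    simp only [numNodes] at hN
    by_cases hv : v = nil
    · subst hv
      rw [treePerm_node_nil, ihu _ (by omega)]
      simp [arcWeight]
    · rw [treePerm_node_of_ne i u hv, card_invSet_glue (by omega)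
        (Nat.lt_add_of_pos_right (numNodes_pos hv)) (by omega) (isNCOn_treePerm u (a + 1))
        (isNCOn_treePerm v _), ihu _ (by omega), ihv _ (by omega), arcWeight, if_neg hv]
      omega

lemma treePerm_injective {t t' : BinaryTree Unit} {a : ℕ} (hn : t.numNodes = t'.numNodes)
    (h : treePerm t a = treePerm t' a) : t = t' := by
  induction t generalizing a t' with
  | nil => cases t' <;> simp_all [numNodes]
  | node i u v ihu ihv =>
    cases t' with
    | nil => simp [numNodes] at hn
    | node i' u' v' =>
    have apply_nil (u : BinaryTree Unit) : treePerm u (a + 1) a = a :=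
      (isNCOn_treePerm u (a + 1)).1 a (by omega)
    have apply_ne (i u) {v : BinaryTree Unit} (hv : v ≠ nil) :
        treePerm (node i u v) a a = a + 1 + u.numNodes := by
      rw [treePerm_node_of_ne i u hv, glue_apply (by omega) (isNCOn_treePerm u (a + 1))
        (isNCOn_treePerm v _)]
      simp
    simp only [numNodes] at hn
    have ha := DFunLike.congr_fun h a
    by_cases hv : v = nil <;> by_cases hv' : v' = nil
    · subst hv hv'
      rw [treePerm_node_nil, treePerm_node_nil] at h
      rw [ihu (by simpa [numNodes] using hn) h]
    · rw [hv, treePerm_node_nil, apply_nil, apply_ne _ _ hv'] at ha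
      omega
    · rw [hv', treePerm_node_nil, apply_nil, apply_ne _ _ hv] at ha
      omega
    · rw [apply_ne _ _ hv, apply_ne _ _ hv'] at ha
      have hu : u.numNodes = u'.numNodes := by omega
      rw [treePerm_node_of_ne _ _ hv, treePerm_node_of_ne _ _ hv', ← hu] at h
      replace h := mul_left_cancel h
      have hu₁ := isNCOn_treePerm u (a + 1)
      have hu₂ := isNCOn_treePerm u' (a + 1)
      rw [← hu] at hu₂
      have heq : treePerm u (a + 1) = treePerm u' (a + 1) := by
        ext x
        by_cases hx : x < a + 1 + u.numNodes
        · have := DFunLike.congr_fun h x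
          rwa [mul_apply_of_disjoint hu₁ (isNCOn_treePerm v _),
            mul_apply_of_disjoint hu₂ (isNCOn_treePerm v' _), if_pos hx, if_pos hx]
            at this
        · rw [hu₁.1 x (by omega), hu₂.1 x (by omega)]
      rw [heq] at h
      rw [ihu hu heq, ihv (by omega) (mul_left_cancel h)]

lemma exists_glue {a b : ℕ} {σ : Equiv.Perm ℕ} (h : IsNCOn a b σ) (ha : σ a ≠ a) :
    ∃ j τ₁ τ₂, a < j ∧ j < b ∧ IsNCOn (a + 1) j τ₁ ∧ IsNCOn j b τ₂ ∧
      σ = Equiv.swap a j * (τ₁ * τ₂) := by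
  have hab : a < b := by
    by_contra! hab
    exact ha (h.1 a (by omega))
  have hj := (h.mem (x := a)).1 ⟨le_rfl, hab⟩
  have f := h.1
  have m := fun x => h.mem (x := x)
  generalize hj' : σ a = j at hj
  have haj : a < j := by omega
  have hin : ∀ x, x ∈ Set.Ioo a j → σ x ∈ Set.Ioo a j := fun x hx =>
    hj' ▸ (h.2 a x).1 hx.1 (hj' ▸ hx.2)
  let τ₁ : Equiv.Perm ℕ := Equiv.Perm.ofSubtype (σ.subtypePermOfFintype hin)
  have e₁ : ∀ x, a < x → x < j → τ₁ x = σ x := fun x h1 h2 => by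
    simp only [τ₁]
    rw [Equiv.Perm.ofSubtype_apply_of_mem _ (show x ∈ Set.Ioo a j from ⟨h1, h2⟩)]
    rfl
  have e₂ : ∀ x, (x ≤ a ∨ j ≤ x) → τ₁ x = x := fun x h1 => by
    simp only [τ₁]
    rw [Equiv.Perm.ofSubtype_apply_of_not_mem]
    rintro ⟨h2, h3⟩
    omega
  have hout : ∀ x, a < σ x → σ x < j → a < x ∧ x < j := by
    intro x h1 h2
    obtain ⟨⟨y, hy⟩, hxy⟩ := (σ.subtypePermOfFintype hin).surjective ⟨σ x, h1, h2⟩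
    have := σ.injective (congrArg Subtype.val hxy)
    exact this ▸ hy
  have h₁ : IsNCOn (a + 1) j τ₁ := by
    refine ⟨fun x hx => e₂ x (by omega), fun x z => ?_⟩
    have := h.2 x z
    have := hin x
    have := hin z
    simp only [Set.mem_Ioo] at *
    by_cases hx : a < x ∧ x < j <;> by_cases hz : a < z ∧ z < j
    · rw [e₁ x hx.1 hx.2, e₁ z hz.1 hz.2]
      omega
    · rw [e₁ x hx.1 hx.2, e₂ z (by omega)]
      omega
    · rw [e₂ x (by omega), e₁ z hz.1 hz.2]
      omega
    · rw [e₂ x (by omega), e₂ z (by omega)]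
      omega
  have inv₁ : ∀ x, (x ≤ a ∨ j ≤ x) → τ₁⁻¹ x = x := fun x h1 => by
    rw [Equiv.Perm.inv_eq_iff_eq, e₂ x h1]
  have g : ∀ x, (τ₁⁻¹ * (Equiv.swap a j * σ)) x =
      if x < j then x else if σ x = a then j else σ x := by
    intro x
    simp only [Equiv.Perm.mul_apply]
    have := hout x
    have := m x
    split_ifs with c1 c2
    · rcases lt_trichotomy x a with c | c | c
      · rw [f x (by omega), Equiv.swap_apply_of_ne_of_ne (by omega) (by omega), inv₁ _ (by omega)]
      · rw [c, hj', Equiv.swap_apply_right, inv₁ _ (by omega)]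
      · have := hin x ⟨c, c1⟩
        simp only [Set.mem_Ioo] at this
        rw [Equiv.swap_apply_of_ne_of_ne (by omega) (by omega), Equiv.Perm.inv_eq_iff_eq,
          e₁ x c c1]
    · rw [c2, Equiv.swap_apply_left, inv₁ _ (by omega)]
    · have : σ x ≠ j := fun hx => by
        have := σ.injective (hx.trans hj'.symm)
        omega
      rw [Equiv.swap_apply_of_ne_of_ne (by omega) (by omega), inv₁]
      omega
  refine ⟨j, τ₁, τ₁⁻¹ * (Equiv.swap a j * σ), haj, hj.2, h₁, ⟨fun x hx => ?_, fun x z => ?_⟩, ?_⟩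
  · rw [g]
    have := f x
    split_ifs <;> omega
  · have := h.2 x z
    have := hout x
    have := hout z
    have := m x
    have := m z
    have := f x
    have := f z
    have := σ.injective.eq_iff (a := x) (b := z)
    have := σ.injective.eq_iff (a := x) (b := a)
    have := σ.injective.eq_iff (a := z) (b := a)
    rw [g, g]
    split_ifs <;> omega
  · rw [mul_inv_cancel_left, ← mul_assoc, Equiv.swap_mul_self, one_mul]

lemma exists_treePerm_eq {a b : ℕ} (hab : a ≤ b) {σ : Equiv.Perm ℕ} (h : IsNCOn a b σ) :
    ∃ t : BinaryTree Unit, a + t.numNodes = b ∧ treePerm t a = σ := by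
  induction hn : b - a using Nat.strong_induction_on generalizing a b σ with
  | _ n ih =>
  subst hn
  rcases hab.eq_or_lt with rfl | hab
  · exact ⟨nil, rfl, Equiv.ext fun x => (h.1 x (by omega)).symm⟩
  by_cases ha : σ a = a
  · have h' : IsNCOn (a + 1) b σ := by
      refine ⟨fun x hx => ?_, h.2⟩
      by_cases hxa : x = a
      · rw [hxa, ha]
      · exact h.1 x (by omega)
    obtain ⟨u, hu, rfl⟩ := ih _ (by omega) (by omega) h' rfl
    exact ⟨node () u nil, by simp only [numNodes]; omega, by simp⟩
  · obtain ⟨j, τ₁, τ₂, haj, hjb, h₁, h₂, rfl⟩ := exists_glue h ha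
    obtain ⟨u, rfl, rfl⟩ := ih _ (by omega) (by omega) h₁ rfl
    obtain ⟨v, rfl, rfl⟩ := ih _ (by omega) (by omega) h₂ rfl
    have hv : v ≠ nil := by
      rintro rfl
      simp [numNodes] at hjb
    exact ⟨node () u v, by simp only [numNodes]; omega, treePerm_node_of_ne _ _ hv _⟩

/-! ### Transfer to permutations of `Fin n` -/

lemma extend_apply {n : ℕ} (σ : Equiv.Perm (Fin n)) (x : Fin n) :
    σ.extendDomain Fin.equivSubtype (x : ℕ) = σ x :=
  Equiv.Perm.extendDomain_apply_image σ Fin.equivSubtype x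

lemma isNCOn_extend_iff {n : ℕ} {σ : Equiv.Perm (Fin n)} :
    IsNCOn 0 n (σ.extendDomain Fin.equivSubtype) ↔ IsNC σ := by
  have hout (x : ℕ) (hx : n ≤ x) : σ.extendDomain Fin.equivSubtype x = x :=
    Equiv.Perm.extendDomain_apply_not_subtype σ _ (by omega)
  rw [isNC_iff_localNC]
  refine ⟨fun h x z => ?_, fun h => ⟨fun x hx => hout x (by omega), fun x z => ?_⟩⟩
  · have := h.2 x z
    rw [extend_apply, extend_apply] at this
    exact_mod_cast this
  · by_cases hx : x < n
    · lift x to Fin n using hx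
      by_cases hz : z < n
      · lift z to Fin n using hz
        rw [extend_apply, extend_apply]
        exact_mod_cast h x z
      · have := (σ x).2
        rw [extend_apply, hout z (by omega)]
        omega
    · rw [hout x (by omega)]
      omega

lemma invP_eq_card_invSet {n : ℕ} (σ : Equiv.Perm (Fin n)) :
    invP σ = (invSet n (σ.extendDomain Fin.equivSubtype)).card := by
  refine Finset.card_bij (fun p _ => (p.1, p.2)) ?_ ?_ ?_
  · rintro ⟨x, y⟩ h
    simp only [invSet, Finset.mem_filter, Finset.mem_product, Finset.mem_range, Finset.mem_univ,
      true_and, extend_apply] at h ⊢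
    exact ⟨⟨x.2, y.2⟩, h⟩
  · rintro ⟨x, y⟩ _ ⟨x', y'⟩ _ h
    simpa [Fin.ext_iff] using h
  · rintro ⟨x, y⟩ h
    simp only [invSet, Finset.mem_filter, Finset.mem_product, Finset.mem_range] at h
    obtain ⟨⟨hx, hy⟩, h⟩ := h
    lift x to Fin n using hx
    lift y to Fin n using hy
    rw [extend_apply, extend_apply] at h
    exact ⟨(x, y), by simpa using h, rfl⟩

lemma exists_extend_eq {n : ℕ} {σ : Equiv.Perm ℕ} (h : IsNCOn 0 n σ) :
    ∃ τ : Equiv.Perm (Fin n), τ.extendDomain Fin.equivSubtype = σ := by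
  have hm (x : ℕ) : σ x < n ↔ x < n := by simpa using h.mem.symm
  refine ⟨Fin.equivSubtype.symm.permCongr (σ.subtypePerm hm), Equiv.ext fun x => ?_⟩
  by_cases hx : x < n
  · lift x to Fin n using hx
    rw [extend_apply]
    rfl
  · rw [Equiv.Perm.extendDomain_apply_not_subtype (p := (· < n)) _ _ hx, h.1 x (by omega)]

lemma exists_bijective_tree_nc (n : ℕ) :
    ∃ F : {t : BinaryTree Unit // t.numNodes = n} → {σ : Equiv.Perm (Fin n) // IsNC σ},
      Function.Bijective F ∧ ∀ t, invP (F t).1 = arcWeight t.1 := by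
  have hNC (t : {t : BinaryTree Unit // t.numNodes = n}) : IsNCOn 0 n (treePerm t.1 0) := by
    simpa [t.2] using isNCOn_treePerm t.1 0
  choose F hF using fun t => exists_extend_eq (hNC t)
  refine ⟨fun t => ⟨F t, isNCOn_extend_iff.1 (hF t ▸ hNC t)⟩, ⟨fun t t' h => ?_, fun σ => ?_⟩,
    fun t => ?_⟩
  · refine Subtype.ext (treePerm_injective (a := 0) (t.2.trans t'.2.symm) ?_)
    rw [← hF, ← hF, show F t = F t' from Subtype.ext_iff.1 h]
  · obtain ⟨t, ht, hσ⟩ := exists_treePerm_eq n.zero_le (isNCOn_extend_iff.2 σ.2)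
    refine ⟨⟨t, by simpa using ht⟩, Subtype.ext (Equiv.ext fun x => Fin.ext ?_)⟩
    rw [← extend_apply, ← extend_apply, hF, hσ]
  · rw [invP_eq_card_invSet, hF, card_invSet_treePerm]
    simp [t.2]

/-! ### Dyck words and their area -/

/-- The statistic on binary trees matching the area of Dyck words. -/
def areaWeight : BinaryTree Unit → ℕ
  | nil => 0
  | node _ u v => areaWeight u + areaWeight v + u.numNodes

/-- Sum of the heights of a word before each up step, starting at height `h`. -/
def heightSum : ℕ → List DyckStep → ℕ
  | _, [] => 0
  | h, .U :: l => h + heightSum (h + 1) l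
  | h, .D :: l => heightSum (h - 1) l

lemma heightSum_ofTree_append (t : BinaryTree Unit) (h : ℕ) (l : List DyckStep) :
    heightSum h ((DyckWord.ofTree t).toList ++ l) =
      h * t.numNodes + areaWeight t + heightSum h l := by
  induction t generalizing h l with
  | nil => simp [DyckWord.ofTree, numNodes, areaWeight, show (0 : DyckWord).toList = [] from rfl]
  | node i u v ihu ihv =>
    have : (DyckWord.ofTree (node i u v)).toList ++ l = .U :: ((DyckWord.ofTree u).toList ++
        (.D :: ((DyckWord.ofTree v).toList ++ l))) := by
      rw [DyckWord.ofTree]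
      change (([.U] ++ (DyckWord.ofTree u).toList ++ [.D]) ++ (DyckWord.ofTree v).toList) ++ l = _
      simp
    rw [this, heightSum, ihu, heightSum, Nat.add_sub_cancel, ihv, numNodes, areaWeight]
    ring

lemma heightSum_eq_areaWeight (p : DyckWord) : heightSum 0 p.toList = areaWeight p.toTree := by
  simpa [DyckWord.ofTree_toTree, heightSum] using heightSum_ofTree_append p.toTree 0 []

/-- Attach a tree `p` to a tree `q`; the result is never empty. -/
def graft (p : BinaryTree Unit) : BinaryTree Unit → BinaryTree Unit
  | nil => node () nil p
  | node _ x y => node () (node () p x) y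

/-- The tree rearrangement turning `arcWeight` into `areaWeight`. -/
def rearrange : BinaryTree Unit → BinaryTree Unit
  | nil => nil
  | node _ u v => graft (rearrange u) (rearrange v)

lemma numNodes_graft (p q : BinaryTree Unit) :
    (graft p q).numNodes = p.numNodes + q.numNodes + 1 := by
  cases q <;> simp only [graft, numNodes] <;> omega

lemma areaWeight_graft (p q : BinaryTree Unit) : areaWeight (graft p q) =
    areaWeight p + areaWeight q + if q = nil then 0 else 2 * p.numNodes + 1 := by
  cases q <;> simp [graft, areaWeight, numNodes]
  omega

lemma graft_ne_nil (p q : BinaryTree Unit) : graft p q ≠ nil := by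
  cases q <;> simp [graft]

lemma graft_inj {p q p' q' : BinaryTree Unit} (h : graft p q = graft p' q') :
    p = p' ∧ q = q' := by
  cases q <;> cases q' <;> simp_all [graft]

lemma exists_graft_eq {t : BinaryTree Unit} (h : t ≠ nil) : ∃ p q, graft p q = t := by
  rcases t with _ | ⟨i, _ | ⟨i', p, x⟩, y⟩
  · exact absurd rfl h
  · exact ⟨y, nil, rfl⟩
  · exact ⟨p, node () x y, rfl⟩

@[simp] lemma numNodes_rearrange (t : BinaryTree Unit) :
    (rearrange t).numNodes = t.numNodes := by
  induction t with
  | nil => rfl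
  | node i u v ihu ihv => rw [rearrange, numNodes_graft, ihu, ihv, numNodes]

lemma rearrange_eq_nil {t : BinaryTree Unit} : rearrange t = nil ↔ t = nil := by
  cases t <;> simp [rearrange, graft_ne_nil]

lemma areaWeight_rearrange (t : BinaryTree Unit) : areaWeight (rearrange t) = arcWeight t := by
  induction t with
  | nil => rfl
  | node i u v ihu ihv =>
    simp only [rearrange, areaWeight_graft, ihu, ihv, numNodes_rearrange, rearrange_eq_nil,
      arcWeight]

lemma rearrange_injective : Function.Injective rearrange := by
  intro t
  induction t with
  | nil => intro t' h; exact (rearrange_eq_nil.1 h.symm).symm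
  | node i u v ihu ihv =>
    rintro (_ | ⟨i', u', v'⟩) h
    · exact absurd h (graft_ne_nil _ _)
    · obtain ⟨h₁, h₂⟩ := graft_inj h
      rw [ihu h₁, ihv h₂]

lemma rearrange_surjective : Function.Surjective rearrange := by
  intro t
  induction hn : t.numNodes using Nat.strong_induction_on generalizing t with
  | _ n ih =>
  subst hn
  by_cases h : t = nil
  · exact ⟨nil, h.symm⟩
  · obtain ⟨p, q, rfl⟩ := exists_graft_eq h
    have := numNodes_graft p q
    obtain ⟨u, rfl⟩ := ih _ (by omega) p rfl
    obtain ⟨v, rfl⟩ := ih _ (by omega) q rfl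
    exact ⟨node () u v, rfl⟩

/-! ### Lattice paths as Dyck words -/

section Path

variable {m : ℕ} (w : Fin m → Bool)

/-- The word of up and down steps of a lattice path. -/
def pathWord : List DyckStep := List.ofFn fun t => if w t then .U else .D

@[simp] lemma length_pathWord : (pathWord w).length = m := by simp [pathWord]

@[simp] lemma countN_zero : countN w 0 = 0 := by simp [countN]

@[simp] lemma countE_zero : countE w 0 = 0 := by simp [countE]

lemma countN_succ {k : ℕ} (hk : k < m) :
    countN w (k + 1) = countN w k + if w ⟨k, hk⟩ = true then 1 else 0 := by
  have : (Finset.univ.filter fun t : Fin m => (t : ℕ) < k + 1 ∧ w t = true) =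
      (Finset.univ.filter fun t : Fin m => (t : ℕ) < k ∧ w t = true) ∪
        if w ⟨k, hk⟩ = true then {⟨k, hk⟩} else ∅ := by
    ext t
    rcases lt_trichotomy (t : ℕ) k with h | h | h
    · split_ifs <;> simp [Fin.ext_iff] <;> grind
    · obtain rfl : t = ⟨k, hk⟩ := Fin.ext h
      split_ifs <;> simp_all
    · split_ifs <;> simp [Fin.ext_iff] <;> grind
  rw [countN, this, Finset.card_union_of_disjoint, countN]
  · split_ifs <;> simp
  · split_ifs <;> simp

lemma countE_succ {k : ℕ} (hk : k < m) :
    countE w (k + 1) = countE w k + if w ⟨k, hk⟩ = true then 0 else 1 := by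
  have h : ∀ k, countE w k = countN (fun t => !w t) k := by simp [countE, countN]
  rw [h, h, countN_succ _ hk]
  cases w ⟨k, hk⟩ <;> simp

lemma countN_of_le {k : ℕ} (hk : m ≤ k) : countN w k = countN w m := by
  simp only [countN]
  congr 1 with t
  grind

lemma countE_of_le {k : ℕ} (hk : m ≤ k) : countE w k = countE w m := by
  simp only [countE]
  congr 1 with t
  grind

lemma countN_mono : Monotone (countN w) := fun k l h =>
  Finset.card_le_card fun t => by
    simp only [Finset.mem_filter, Finset.mem_univ, true_and]
    exact fun ht => ⟨ht.1.trans_le h, ht.2⟩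

lemma countN_add_countE {k : ℕ} (hk : k ≤ m) : countN w k + countE w k = k := by
  induction k with
  | zero => simp
  | succ k ih =>
    rw [countN_succ w hk, countE_succ w hk]
    have := ih (by omega)
    split_ifs <;> omega

lemma count_take_pathWord (k : ℕ) : ((pathWord w).take k).count .U = countN w k ∧
    ((pathWord w).take k).count .D = countE w k := by
  induction k with
  | zero => simp
  | succ k ih =>
    by_cases hk : k < m
    · rw [List.take_succ_eq_append_getElem (by simpa using hk), List.count_append,
        List.count_append, ih.1, ih.2, countN_succ w hk, countE_succ w hk]
      simp only [pathWord, List.getElem_ofFn]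
      split_ifs <;> simp
    · rw [List.take_of_length_le (by simp; omega)] at ih ⊢
      rwa [countN_of_le w (by omega), countE_of_le w (by omega),
        ← countN_of_le w (k := k) (by omega), ← countE_of_le w (k := k) (by omega)]

/-- The cells above the diagonal lying below the first `k` steps of a path. -/
def cellsUpTo (k : ℕ) : Set (ℕ × ℕ) :=
  {p | 1 ≤ p.1 ∧ p.1 < p.2 ∧ ∃ l ≤ k, countE w l < p.1 ∧ p.2 ≤ countN w l}

lemma finite_cellsUpTo (k : ℕ) : (cellsUpTo w k).Finite := by
  refine ((Set.finite_Iic (countN w k)).prod (Set.finite_Iic (countN w k))).subset ?_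
  rintro ⟨i, j⟩ ⟨-, h, l, hl, -, h'⟩
  have := countN_mono w hl
  simp only [Set.mem_prod, Set.mem_Iic] at *
  omega

lemma areaA_eq_ncard_cellsUpTo : areaA w = (cellsUpTo w m).ncard := by
  rw [areaA]
  congr 1 with ⟨i, j⟩
  refine and_congr_right fun _ => and_congr_right fun _ => ⟨fun ⟨k, hk⟩ => ?_, fun ⟨k, _, hk⟩ =>
    ⟨k, hk⟩⟩
  rcases le_total k m with h | h
  · exact ⟨k, h, hk⟩
  · rw [countE_of_le w h, countN_of_le w h] at hk
    exact ⟨m, le_rfl, hk⟩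

lemma ncard_cellsUpTo_succ {k : ℕ} (hk : k < m) : (cellsUpTo w (k + 1)).ncard =
    (cellsUpTo w k).ncard + if w ⟨k, hk⟩ = true then countN w k - countE w k else 0 := by
  have hN := countN_succ w hk
  have hE := countE_succ w hk
  have split (P : ℕ → Prop) : (∃ l ≤ k + 1, P l) ↔ (∃ l ≤ k, P l) ∨ P (k + 1) := by
    simp only [Nat.le_succ_iff, or_and_right, exists_or, exists_eq_left]
  split_ifs at hN hE ⊢ with hw
  · have : cellsUpTo w (k + 1) = cellsUpTo w k ∪
        (fun i => (i, countN w k + 1)) '' Finset.Ioc (countE w k) (countN w k) := by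
      ext ⟨i, j⟩
      simp only [cellsUpTo, split, Set.mem_union, Set.mem_ofPred_eq, Set.mem_image,
        Finset.coe_Ioc, Set.mem_Ioc, Prod.mk.injEq]
      constructor
      · rintro ⟨h1, h2, h | h⟩
        · exact Or.inl ⟨h1, h2, h⟩
        · by_cases hj : j ≤ countN w k
          · exact Or.inl ⟨h1, h2, k, le_rfl, by omega⟩
          · exact Or.inr ⟨i, by omega⟩
      · rintro (⟨h1, h2, h⟩ | ⟨i, h1, rfl, rfl⟩)
        · exact ⟨h1, h2, Or.inl h⟩
        · exact ⟨by omega, by omega, Or.inr (by omega)⟩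
    rw [this, Set.ncard_union_eq _ (finite_cellsUpTo w k) (Set.toFinite _),
      Set.ncard_image_of_injective _ fun x y => by simp, Set.ncard_coe_finset, Nat.card_Ioc]
    rw [Set.disjoint_left]
    rintro _ ⟨-, -, l, hl, -, h⟩ ⟨i, -, rfl⟩
    have := countN_mono w hl
    simp only at h
    omega
  · rw [add_zero]
    congr 1 with ⟨i, j⟩
    simp only [cellsUpTo, split, Set.mem_ofPred_eq]
    refine and_congr_right fun _ => and_congr_right fun _ => or_iff_left_of_imp fun h =>
      ⟨k, le_rfl, by omega⟩

lemma heightSum_pathWord (hw : ∀ k, countE w k ≤ countN w k) :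
    heightSum 0 (pathWord w) = areaA w := by
  have key (k : ℕ) (hk : k ≤ m) : heightSum 0 (pathWord w) = (cellsUpTo w k).ncard +
      heightSum (countN w k - countE w k) ((pathWord w).drop k) := by
    induction k with
    | zero =>
      have : cellsUpTo w 0 = ∅ := by
        ext ⟨i, j⟩
        simp [cellsUpTo]
        omega
      simp [this]
    | succ k ih =>
      have := hw k
      rw [ih (by omega), ncard_cellsUpTo_succ w hk, countN_succ w hk, countE_succ w hk,
        List.drop_eq_getElem_cons (by simpa using hk)]
      simp only [pathWord, List.getElem_ofFn]
      split_ifs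
      · rw [heightSum, add_zero, Nat.sub_add_comm this]
        omega
      · rw [heightSum, add_zero, add_zero, Nat.sub_sub]
  rw [key m le_rfl, areaA_eq_ncard_cellsUpTo, List.drop_of_length_le (by simp), heightSum, add_zero]

lemma pathWord_injective : Function.Injective (pathWord (m := m)) := fun w w' h => by
  ext t
  have := congrFun (List.ofFn_injective h) t
  cases hw : w t <;> cases hw' : w' t <;> simp_all

end Path

/-- The Dyck word of a Dyck path. -/
def dyckWord {n : ℕ} {w : Fin (2 * n) → Bool} (h : IsDyckA n w) : DyckWord where
  toList := pathWord w
  count_U_eq_count_D := by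
    have h₁ := count_take_pathWord w (2 * n)
    have h₂ := countN_add_countE w le_rfl
    rw [List.take_of_length_le (by simp), h.1] at h₁
    rw [h.1] at h₂
    omega
  count_D_le_count_U k := by
    rw [(count_take_pathWord w k).1, (count_take_pathWord w k).2]
    exact h.2 k

lemma semilength_dyckWord {n : ℕ} {w : Fin (2 * n) → Bool} (h : IsDyckA n w) :
    (dyckWord h).semilength = n := by
  have := (dyckWord h).two_mul_semilength_eq_length
  simp only [dyckWord, length_pathWord] at this ⊢
  omega

lemma exists_dyckWord_eq {n : ℕ} {p : DyckWord} (hp : p.semilength = n) :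
    ∃ (w : Fin (2 * n) → Bool) (h : IsDyckA n w), dyckWord h = p := by
  have hlen : p.toList.length = 2 * n := by rw [← p.two_mul_semilength_eq_length, hp]
  let w : Fin (2 * n) → Bool := fun t => decide (p.toList[(t : ℕ)] = .U)
  have hw : pathWord w = p.toList := by
    refine List.ext_getElem (by simp [hlen]) fun k h₁ h₂ => ?_
    simp only [pathWord, List.getElem_ofFn, w, decide_eq_true_eq]
    rcases p.toList[k].dichotomy with h | h <;> simp [h]
  have hcount := count_take_pathWord w
  rw [hw] at hcount
  refine ⟨w, ⟨?_, fun k => ?_⟩, DyckWord.ext hw⟩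
  · rw [← (hcount _).1, List.take_of_length_le hlen.le]
    exact hp
  · rw [← (hcount k).1, ← (hcount k).2]
    exact p.count_D_le_count_U k

lemma exists_bijective_path_tree (n : ℕ) :
    ∃ G : {w : Fin (2 * n) → Bool // IsDyckA n w} → {t : BinaryTree Unit // t.numNodes = n},
      Function.Bijective G ∧ ∀ w, areaA w.1 = areaWeight (G w).1 := by
  refine ⟨fun w => ⟨(dyckWord w.2).toTree, by
    rw [DyckWord.numNodes_toTree, semilength_dyckWord]⟩, ⟨fun w w' h => ?_, fun t => ?_⟩,
    fun w => ?_⟩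
  · have := DyckWord.equivTree.injective (Subtype.ext_iff.1 h)
    exact Subtype.ext (pathWord_injective (congrArg DyckWord.toList this))
  · have ht : (DyckWord.ofTree t.1).semilength = n := by
      rw [← DyckWord.numNodes_toTree, DyckWord.toTree_ofTree, t.2]
    obtain ⟨w, hw, h⟩ := exists_dyckWord_eq ht
    refine ⟨⟨w, hw⟩, Subtype.ext ?_⟩
    simp only [h, DyckWord.toTree_ofTree]
  · rw [← heightSum_eq_areaWeight, ← heightSum_pathWord _ w.2.2]
    rfl

/-- For every `n ≥ 1` there is a bijection `φ` from Dyck paths of length `n`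
onto non-crossing permutations of `{1,…,n}` with `area(w) = inv(φ(w))`. -/
theorem exists_bijection_area_inv (n : ℕ) (hn : 1 ≤ n) :
    ∃ φ : {w : Fin (2 * n) → Bool // IsDyckA n w} → {σ : Equiv.Perm (Fin n) // IsNC σ},
      Function.Bijective φ ∧ ∀ w, areaA w.1 = invP (φ w).1 := by
  obtain ⟨F, hF, hF'⟩ := exists_bijective_tree_nc n
  obtain ⟨G, hG, hG'⟩ := exists_bijective_path_tree n
  let e : {t : BinaryTree Unit // t.numNodes = n} ≃ {t : BinaryTree Unit // t.numNodes = n} :=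
    (Equiv.ofBijective rearrange ⟨rearrange_injective, rearrange_surjective⟩).subtypeEquiv
      fun t => show t.numNodes = n ↔ (rearrange t).numNodes = n by rw [numNodes_rearrange]
  refine ⟨F ∘ e.symm ∘ G, hF.comp (e.symm.bijective.comp hG), fun w => ?_⟩
  have he : rearrange (e.symm (G w)).1 = (G w).1 := congrArg Subtype.val (e.apply_symm_apply (G w))
  rw [hG', Function.comp_apply, Function.comp_apply, hF', ← areaWeight_rearrange, he]

end Stmt
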